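/- arXiv:1705.03875 — 6 statements merged into one kernel-verified Lean document; each statement's English description precedes it below -/
import Mathlib

section
/- Let N₁, N₂, P, s be positive real numbers with s² > N₁·N₂/P and s < N₁. Then P − P·s/N₂ + N₁/s < P − P·s²/(N₁·N₂) + 1. That is, the worst-case number of processors K_coded = P − Ps/N₂ + N₁/s for an (N₁,N₂,P,s) coded convolution is strictly smaller than the worst-case number K_rep = P − Ps²/(N₁N₂) + 1 for a (P,r) replication strategy with the same per-processor load s = √(N₁N₂r/P). -/
/-- The worst-case number of processors for an (N₁,N₂,P,s) coded convolution,
K_coded = P − Ps/N₂ + N₁/s, is strictly smaller than that of a (P,r) replication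
strategy with the same per-processor load, K_rep = P − Ps²/(N₁N₂) + 1. -/
theorem coded_beats_replication (N₁ N₂ P s : ℝ) (hN₁ : 0 < N₁) (hN₂ : 0 < N₂)
    (hP : 0 < P) (hs : 0 < s) (h1 : N₁ * N₂ / P < s ^ 2) (h2 : s < N₁) :
    P - P * s / N₂ + N₁ / s < P - P * s ^ 2 / (N₁ * N₂) + 1 := by
  rw [div_lt_iff₀ hP] at h1
  have key : (P - P * s ^ 2 / (N₁ * N₂) + 1) - (P - P * s / N₂ + N₁ / s)
      = (N₁ - s) * (s ^ 2 * P - N₁ * N₂) / (N₁ * N₂ * s) := by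
    field_simp
    ring
  have hpos : 0 < (N₁ - s) * (s ^ 2 * P - N₁ * N₂) / (N₁ * N₂ * s) :=
    div_pos (mul_pos (sub_pos.mpr h2) (sub_pos.mpr h1)) (by positivity)
  linarith
end

section
/- Let m ≤ n be natural numbers and let g : Fin n → ℝ be injective. Let a : Fin m → Polynomial ℝ be arbitrary polynomials and define the coded polynomials ã : Fin n → Polynomial ℝ by ã k = ∑_{i : Fin m} (g k)^(i : ℕ) • a i. Then for every injective map L : Fin m → Fin n there exists a matrix B : Fin m → Fin m → ℝ such that for every polynomial x : Polynomial ℝ and every i : Fin m, a i * x = ∑_{j : Fin m} B i j • (ã (L j) * x). In other words, each original convolution a_i ∗ x can be recovered by the same fixed linear combination of any m of the n coded convolutions ã_k ∗ x. -/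
/-- Coded convolution decodability: with Vandermonde encoding ã_k = ∑ᵢ g_k^i • aᵢ
on distinct nodes g, for any choice L of m of the n coded pieces there is a fixed
decoding matrix B such that every original convolution aᵢ ∗ x is the corresponding
linear combination of the coded convolutions ã_{L j} ∗ x. -/
theorem coded_convolution_decoding (m n : ℕ) (hmn : m ≤ n) (g : Fin n → ℝ)
    (hg : Function.Injective g) (a : Fin m → Polynomial ℝ) :
    ∀ L : Fin m → Fin n, Function.Injective L →
      ∃ B : Fin m → Fin m → ℝ, ∀ (x : Polynomial ℝ) (i : Fin m),
        a i * x = ∑ j : Fin m, B i j • ((∑ k : Fin m, (g (L j)) ^ (k : ℕ) • a k) * x) := by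
  intro L hL
  have hdet : (Matrix.vandermonde (fun j => g (L j))).det ≠ 0 :=
    Matrix.det_vandermonde_ne_zero_iff.mpr (hg.comp hL)
  have hinv := Matrix.nonsing_inv_mul (Matrix.vandermonde (fun j => g (L j)))
    (isUnit_iff_ne_zero.mpr hdet)
  refine ⟨fun i j => (Matrix.vandermonde (fun j => g (L j)))⁻¹ i j, fun x i => ?_⟩
  have key : ∀ k : Fin m, ∑ j, (Matrix.vandermonde (fun j => g (L j)))⁻¹ i j * g (L j) ^ (k : ℕ)
      = if i = k then 1 else 0 := by
    intro k
    have h := congrFun (congrFun hinv i) k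
    rw [Matrix.mul_apply, Matrix.one_apply] at h
    simpa only [Matrix.vandermonde_apply] using h
  simp_rw [← smul_mul_assoc, Finset.smul_sum, smul_smul]
  rw [← Finset.sum_mul, Finset.sum_comm]
  simp_rw [← Finset.sum_smul, key]
  simp
end

section
/- Let μ > 0, α > 0 and T > 0 be real numbers. Then the function t ↦ Real.log (Real.exp ((μ·(t/T − 1))^α) − 1) / t^α tends to μ^α / T^α as t → ∞ (filter atTop on ℝ). -/
/-- Under the shifted Weibull model, log(exp((μ(t/T−1))^α) − 1)/t^α → μ^α/T^α
as the deadline t → ∞. -/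
theorem weibull_odds_exponent (μ α T : ℝ) (hμ : 0 < μ) (hα : 0 < α) (hT : 0 < T) :
    Filter.Tendsto
      (fun t : ℝ => Real.log (Real.exp ((μ * (t / T - 1)) ^ α) - 1) / t ^ α)
      Filter.atTop (nhds (μ ^ α / T ^ α)) := by
  have hb : Filter.Tendsto (fun t : ℝ => μ * (t / T - 1)) Filter.atTop Filter.atTop :=
    ((Filter.tendsto_atTop_add_const_right _ (-1 : ℝ)
      (Filter.tendsto_id.atTop_div_const hT)).const_mul_atTop hμ)
  have hx : Filter.Tendsto (fun t : ℝ => (μ * (t / T - 1)) ^ α) Filter.atTop Filter.atTop :=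
    (tendsto_rpow_atTop hα).comp hb
  have hlog : Filter.Tendsto
      (fun t : ℝ => Real.log (1 - Real.exp (-((μ * (t / T - 1)) ^ α)))) Filter.atTop (nhds 0) := by
    have h1 := (Real.tendsto_exp_neg_atTop_nhds_zero.comp hx).const_sub 1
    have h2 := h1.log (by norm_num)
    simpa using h2
  have hrem := hlog.div_atTop (tendsto_rpow_atTop hα)
  have hmain : Filter.Tendsto (fun t : ℝ => (μ * (1 / T - t⁻¹)) ^ α) Filter.atTop
      (nhds ((μ * (1 / T - 0)) ^ α)) :=
    ((tendsto_inv_atTop_zero.const_sub (1 / T)).const_mul μ).rpow_const (Or.inr hα.le)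
  have hsum := hmain.add hrem
  have hlim : (μ * (1 / T - 0)) ^ α + 0 = μ ^ α / T ^ α := by
    rw [← Real.div_rpow hμ.le hT.le, add_zero, sub_zero, mul_one_div]
  rw [hlim] at hsum
  refine hsum.congr' ?_
  filter_upwards [Filter.eventually_gt_atTop 0, hb.eventually_gt_atTop 0,
    hx.eventually_gt_atTop 0] with t ht hbt hxt
  have e1 : (μ * (1 / T - t⁻¹)) = (μ * (t / T - 1)) / t := by field_simp
  rw [e1, Real.div_rpow hbt.le ht.le, ← add_div]
  congr 1
  generalize (μ * (t / T - 1)) ^ α = x at hxt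
  have hlt : Real.exp (-x) < 1 := by simpa using hxt
  have e2 : Real.exp x - 1 = Real.exp x * (1 - Real.exp (-x)) := by
    rw [mul_sub, ← Real.exp_add]; simp
  rw [e2, Real.log_mul (Real.exp_pos x).ne' (by linarith), Real.log_exp]
end

section
/- Let μ > 0, α > 0, C > 0, and N₁, N₂, P > 0 be real numbers, let P also denote a natural number of processors Pₙ ≥ 1, and set s = √(N₁N₂/P) with 2s > 1, and T = 2Cs·Real.log (2s) > 0. Define F(t) = 1 − Real.exp (−(μ·(t/T − 1))^α). Then the function t ↦ Real.log (1 − F(t)^{Pₙ}) / t^α tends to −μ^α / T^α as t → ∞. That is, for the naive uncoded strategy (which fails exactly when at most Pₙ−1 processors have finished) the leading coefficient of the failure exponent is exactly −μ^α/(2C√(N₁N₂/P)·log(2√(N₁N₂/P)))^α. -/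
/-- For the naive uncoded strategy with per-processor load s = √(N₁N₂/P) and
shift T = 2Cs·log(2s), the failure probability 1 − F(t)^P (all P processors must
finish) satisfies log(1 − F(t)^P)/t^α → −μ^α/T^α as t → ∞. -/
theorem uncoded_failure_exponent (μ α C N₁ N₂ P : ℝ) (hμ : 0 < μ) (hα : 0 < α)
    (hC : 0 < C) (hN₁ : 0 < N₁) (hN₂ : 0 < N₂) (hP : 0 < P)
    (Pₙ : ℕ) (hPₙ : 1 ≤ Pₙ) (s T : ℝ) (hs : s = Real.sqrt (N₁ * N₂ / P))
    (h2s : 1 < 2 * s) (hT : T = 2 * C * s * Real.log (2 * s)) :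
    Filter.Tendsto
      (fun t : ℝ =>
        Real.log (1 - (1 - Real.exp (-((μ * (t / T - 1)) ^ α))) ^ Pₙ) / t ^ α)
      Filter.atTop (nhds (-(μ ^ α / T ^ α))) := by
  have hs0 : 0 < s := by linarith
  have hT0 : 0 < T := by
    rw [hT]
    have := Real.log_pos h2s
    positivity
  have hpow : Filter.Tendsto (fun t : ℝ => t ^ α) Filter.atTop Filter.atTop :=
    tendsto_rpow_atTop hα
  have hlim : Filter.Tendsto (fun t : ℝ => -((μ * (t / T - 1)) ^ α) / t ^ α)
      Filter.atTop (nhds (-(μ ^ α / T ^ α))) := by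
    have h1 : Filter.Tendsto (fun t : ℝ => μ * (1 / T - t⁻¹)) Filter.atTop
        (nhds (μ * (1 / T - 0))) :=
      (tendsto_const_nhds.sub tendsto_inv_atTop_zero).const_mul μ
    have h2 := (h1.rpow_const (p := α) (Or.inr hα.le)).neg
    have e : μ * (1 / T - 0) = μ / T := by ring
    rw [e, Real.div_rpow hμ.le hT0.le] at h2
    refine h2.congr' ?_
    filter_upwards [Filter.eventually_ge_atTop T] with t ht
    have ht0 : 0 < t := lt_of_lt_of_le hT0 ht
    have h3 : 0 ≤ t / T - 1 := by
      rw [sub_nonneg, le_div_iff₀ hT0]; linarith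
    rw [neg_div, ← Real.div_rpow (by positivity) ht0.le]
    congr 2
    field_simp
  have hlim2 : Filter.Tendsto
      (fun t : ℝ => Real.log Pₙ / t ^ α + -((μ * (t / T - 1)) ^ α) / t ^ α)
      Filter.atTop (nhds (-(μ ^ α / T ^ α))) := by
    simpa using (hpow.const_div_atTop (Real.log Pₙ)).add hlim
  have key : ∀ t : ℝ, T ≤ t →
      -((μ * (t / T - 1)) ^ α) ≤
        Real.log (1 - (1 - Real.exp (-((μ * (t / T - 1)) ^ α))) ^ Pₙ) ∧
      Real.log (1 - (1 - Real.exp (-((μ * (t / T - 1)) ^ α))) ^ Pₙ) ≤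
        Real.log Pₙ + -((μ * (t / T - 1)) ^ α) := by
    intro t ht
    have h3 : 0 ≤ t / T - 1 := by
      rw [sub_nonneg, le_div_iff₀ hT0]; linarith
    have hy : 0 ≤ (μ * (t / T - 1)) ^ α := by positivity
    generalize (μ * (t / T - 1)) ^ α = y at hy
    have hx0 : 0 < Real.exp (-y) := Real.exp_pos _
    have hx1 : Real.exp (-y) ≤ 1 := Real.exp_le_one_iff.2 (by linarith)
    have hlow : Real.exp (-y) ≤ 1 - (1 - Real.exp (-y)) ^ Pₙ := by
      have := pow_le_of_le_one (a := 1 - Real.exp (-y)) (by linarith) (by linarith)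
        (n := Pₙ) (by omega)
      linarith
    have hup : 1 - (1 - Real.exp (-y)) ^ Pₙ ≤ Pₙ * Real.exp (-y) := by
      have := one_add_mul_le_pow (a := -Real.exp (-y)) (by linarith) Pₙ
      rw [← sub_eq_add_neg] at this
      linarith
    have hPpos : (0 : ℝ) < Pₙ := by exact_mod_cast hPₙ
    constructor
    · have := Real.log_le_log hx0 hlow
      rwa [Real.log_exp] at this
    · have := Real.log_le_log (lt_of_lt_of_le hx0 hlow) hup
      rwa [Real.log_mul hPpos.ne' hx0.ne', Real.log_exp] at this
  refine tendsto_of_tendsto_of_tendsto_of_le_of_le' hlim hlim2 ?_ ?_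
  · filter_upwards [Filter.eventually_ge_atTop T] with t ht
    have ht0 : 0 < t := lt_of_lt_of_le hT0 ht
    exact div_le_div_of_nonneg_right (key t ht).1 (by positivity)
  · filter_upwards [Filter.eventually_ge_atTop T] with t ht
    have ht0 : 0 < t := lt_of_lt_of_le hT0 ht
    rw [← add_div]
    exact div_le_div_of_nonneg_right (key t ht).2 (by positivity)
end

section
/- Let N₁, N₂, P, C, μ, α be positive real numbers, set s₀ = √(N₁N₂/P), and suppose s₀ ≥ 1. Define ε(s) = −((P·s/N₂ − N₁/s + 1)·μ^α) / (2·C·s·Real.log (2s))^α. Then |ε(2s₀)| / |ε(s₀)| = ((3/2)·√(P·N₁/N₂) + 1) / (2^α·(1 + Real.log 2 / Real.log (2s₀))^α) and in particular |ε(2s₀)| / |ε(s₀)| > 3·√(P·N₁/N₂) / (2·4^α). Hence, when N₁ = Θ(N₂), the ratio of the failure-exponent coefficient of the (N₁,N₂,P,2√(N₁N₂/P)) coded convolution to that of the naive uncoded strategy scales as Ω(√P). -/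
/-- With ε(s) = −((Ps/N₂ − N₁/s + 1)μ^α)/((2Cs·log(2s))^α) and s₀ = √(N₁N₂/P) ≥ 1,
the ratio of the coded (s = 2s₀) to the uncoded (s = s₀) failure-exponent
coefficients equals ((3/2)√(PN₁/N₂)+1)/(2^α(1+log2/log(2s₀))^α) and in particular
exceeds 3√(PN₁/N₂)/(2·4^α), i.e. scales as Ω(√P). -/
theorem coded_exponent_ratio (N₁ N₂ P C μ α : ℝ) (hN₁ : 0 < N₁) (hN₂ : 0 < N₂)
    (hP : 0 < P) (hC : 0 < C) (hμ : 0 < μ) (hα : 0 < α)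
    (s₀ : ℝ) (hs₀ : s₀ = Real.sqrt (N₁ * N₂ / P)) (hs₀1 : 1 ≤ s₀)
    (ε : ℝ → ℝ)
    (hε : ∀ s : ℝ, ε s =
      -((P * s / N₂ - N₁ / s + 1) * μ ^ α) / (2 * C * s * Real.log (2 * s)) ^ α) :
    |ε (2 * s₀)| / |ε s₀| =
      ((3 / 2) * Real.sqrt (P * N₁ / N₂) + 1) /
        ((2 : ℝ) ^ α * (1 + Real.log 2 / Real.log (2 * s₀)) ^ α) ∧
    3 * Real.sqrt (P * N₁ / N₂) / (2 * (4 : ℝ) ^ α) < |ε (2 * s₀)| / |ε s₀| := by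
  have hs : 0 < s₀ := by linarith
  have hsq : s₀ ^ 2 = N₁ * N₂ / P := by
    rw [hs₀]; exact Real.sq_sqrt (by positivity)
  have hsq' : s₀ ^ 2 * P = N₁ * N₂ := by rw [hsq]; field_simp
  have hr : Real.sqrt (P * N₁ / N₂) = P * s₀ / N₂ := by
    rw [Real.sqrt_eq_iff_mul_self_eq (by positivity) (by positivity)]
    field_simp
    linarith
  have hr2 : N₁ / s₀ = P * s₀ / N₂ := by
    field_simp
    linarith
  have hr3 : N₁ / (2 * s₀) = P * s₀ / N₂ / 2 := by
    rw [← hr2]; field_simp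
  have hr4 : P * (2 * s₀) / N₂ = 2 * (P * s₀ / N₂) := by ring
  have hrpos : 0 < P * s₀ / N₂ := by positivity
  have hl2 : 0 < Real.log 2 := Real.log_pos (by norm_num)
  have hL2 : Real.log 2 ≤ Real.log (2 * s₀) := Real.log_le_log (by norm_num) (by linarith)
  have hlog : Real.log (2 * (2 * s₀)) = Real.log 2 + Real.log (2 * s₀) :=
    Real.log_mul (by norm_num) (by positivity)
  rw [hr]
  have e1 := hε s₀
  have e2 := hε (2 * s₀)
  rw [hr2] at e1
  rw [hr3, hr4, hlog] at e2
  generalize P * s₀ / N₂ = r at *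
  generalize Real.log (2 * s₀) = L at *
  have hL : 0 < L := by linarith
  have hden : 2 * C * (2 * s₀) * (Real.log 2 + L)
      = (2 * C * s₀ * L) * (2 * (1 + Real.log 2 / L)) := by
    field_simp
    ring
  have hq : 0 < 1 + Real.log 2 / L := by positivity
  have hD : 0 < 2 * C * s₀ * L := by positivity
  rw [hden, Real.mul_rpow hD.le (by positivity), Real.mul_rpow (by norm_num) hq.le] at e2
  have hq2 : 1 + Real.log 2 / L ≤ 2 := by
    have : Real.log 2 / L ≤ 1 := (div_le_one hL).2 hL2
    linarith
  have hqa : (1 + Real.log 2 / L) ^ α ≤ 2 ^ α := Real.rpow_le_rpow hq.le hq2 hα.le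
  have h4 : (4 : ℝ) ^ α = 2 ^ α * 2 ^ α := by
    rw [← Real.mul_rpow (by norm_num) (by norm_num)]; norm_num
  have hDa := Real.rpow_pos_of_pos hD α
  have hqp := Real.rpow_pos_of_pos hq α
  have hma := Real.rpow_pos_of_pos hμ α
  have h2a : (0 : ℝ) < 2 ^ α := Real.rpow_pos_of_pos (by norm_num) α
  have main : |ε (2 * s₀)| / |ε s₀| =
      ((3 / 2) * r + 1) / ((2 : ℝ) ^ α * (1 + Real.log 2 / L) ^ α) := by
    rw [e1, e2]
    generalize (2 * C * s₀ * L) ^ α = D at *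
    generalize (1 + Real.log 2 / L) ^ α = Q at *
    generalize (2 : ℝ) ^ α = T at *
    generalize μ ^ α = M at *
    rw [neg_div, neg_div, abs_neg, abs_neg, abs_of_pos, abs_of_pos]
    · have : r - r + 1 = 1 := by ring
      rw [this]
      field_simp
      ring
    · have : r - r + 1 = 1 := by ring
      rw [this]
      positivity
    · have : 0 < 2 * r - r / 2 + 1 := by linarith
      positivity
  refine ⟨main, ?_⟩
  rw [main, h4]
  calc 3 * r / (2 * (2 ^ α * 2 ^ α)) = (3 / 2 * r) / (2 ^ α * 2 ^ α) := by
        field_simp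
    _ < (3 / 2 * r + 1) / (2 ^ α * 2 ^ α) := by
        gcongr
        linarith
    _ ≤ _ := by
        gcongr
end

section
/- Let N₁, N₂, P, α be positive real numbers, set s₀ = √(N₁N₂/P), and suppose Real.log (2s₀) > 0. Then the derivative value E'(s₀) = 2P/N₂ − α·√(P/(N₁N₂)) − α·√(P/(N₁N₂))/Real.log (2s₀) is strictly positive if and only if α < 2·√(P·N₁/N₂)·(1 + 1/Real.log (2·√(N₁N₂/P)))⁻¹. In particular, under this condition there exists s strictly greater than √(N₁N₂/P) (i.e., in the coded regime) with E(s) > E(s₀), so some coded convolution strategy strictly outperforms the uncoded strategy in asymptotic failure exponent. -/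
/-- At s₀ = √(N₁N₂/P), the derivative value
E'(s₀) = 2P/N₂ − α√(P/(N₁N₂)) − α√(P/(N₁N₂))/log(2s₀) is positive iff
α < 2√(PN₁/N₂)(1 + 1/log(2√(N₁N₂/P)))⁻¹; under this condition there is some
s > √(N₁N₂/P) in the coded regime with E(s) > E(s₀), where
E(s) = log(Ps/N₂ − N₁/s + 1) − α·log(2s·log(2s)). -/
theorem coded_regime_improves (N₁ N₂ P α : ℝ) (hN₁ : 0 < N₁) (hN₂ : 0 < N₂)
    (hP : 0 < P) (hα : 0 < α) (s₀ : ℝ) (hs₀ : s₀ = Real.sqrt (N₁ * N₂ / P))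
    (hlog : 0 < Real.log (2 * s₀)) :
    (0 < 2 * P / N₂ - α * Real.sqrt (P / (N₁ * N₂)) -
        α * Real.sqrt (P / (N₁ * N₂)) / Real.log (2 * s₀) ↔
      α < 2 * Real.sqrt (P * N₁ / N₂) *
        (1 + 1 / Real.log (2 * Real.sqrt (N₁ * N₂ / P)))⁻¹) ∧
    (α < 2 * Real.sqrt (P * N₁ / N₂) *
        (1 + 1 / Real.log (2 * Real.sqrt (N₁ * N₂ / P)))⁻¹ →
      ∃ s : ℝ, Real.sqrt (N₁ * N₂ / P) < s ∧
        Real.log (P * s₀ / N₂ - N₁ / s₀ + 1) -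
            α * Real.log (2 * s₀ * Real.log (2 * s₀)) <
          Real.log (P * s / N₂ - N₁ / s + 1) -
            α * Real.log (2 * s * Real.log (2 * s))) := by
  have hq : 0 < N₁ * N₂ / P := by positivity
  have hs : 0 < s₀ := by rw [hs₀]; exact Real.sqrt_pos.mpr hq
  have hsq : s₀ ^ 2 * P = N₁ * N₂ := by
    rw [hs₀, Real.sq_sqrt hq.le]; field_simp
  have h1 : Real.sqrt (P / (N₁ * N₂)) = 1 / s₀ := by
    rw [Real.sqrt_eq_iff_mul_self_eq (by positivity) (by positivity), ← hsq]
    field_simp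
  have h2 : Real.sqrt (P * N₁ / N₂) = P * s₀ / N₂ := by
    rw [Real.sqrt_eq_iff_mul_self_eq (by positivity) (by positivity)]
    field_simp
    linear_combination -hsq
  rw [← hs₀, h1, h2]
  have hiff : (0 < 2 * P / N₂ - α * (1 / s₀) - α * (1 / s₀) / Real.log (2 * s₀) ↔
      α < 2 * (P * s₀ / N₂) * (1 + 1 / Real.log (2 * s₀))⁻¹) := by
    generalize Real.log (2 * s₀) = L at hlog
    have hL : 0 < 1 + 1 / L := by positivity
    rw [← div_eq_mul_inv, lt_div_iff₀ hL]
    have e : 2 * P / N₂ - α * (1 / s₀) - α * (1 / s₀) / L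
        = (2 * (P * s₀ / N₂) - α * (1 + 1 / L)) / s₀ := by
      field_simp
      ring
    rw [e, div_pos_iff_of_pos_right hs, sub_pos]
  refine ⟨hiff, fun h => ?_⟩
  have hpos := hiff.mpr h
  have hone : P * s₀ / N₂ - N₁ / s₀ + 1 = 1 := by
    field_simp
    linear_combination hsq
  have hd1 : HasDerivAt (fun s : ℝ => P * s / N₂ - N₁ / s + 1) (2 * P / N₂) s₀ := by
    have a := (((hasDerivAt_id s₀).const_mul P).div_const N₂).sub
      ((hasDerivAt_inv hs.ne').const_mul N₁)
    have b := a.add_const 1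
    refine b.congr_deriv ?_
    field_simp
    linear_combination -hsq
  have hd2 : HasDerivAt (fun s : ℝ => 2 * s) 2 s₀ := by
    simpa using (hasDerivAt_id s₀).const_mul (2 : ℝ)
  have hd3 := hd2.mul (hd2.log (by positivity))
  have hd4 := (hd1.log (by rw [hone]; norm_num)).sub
    ((hd3.log (by simp only [Pi.mul_apply]; positivity)).const_mul α)
  have hd : HasDerivAt (fun s : ℝ => Real.log (P * s / N₂ - N₁ / s + 1) -
            α * Real.log (2 * s * Real.log (2 * s)))
      (2 * P / N₂ - α * (1 / s₀) - α * (1 / s₀) / Real.log (2 * s₀)) s₀ := by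
    refine hd4.congr_deriv ?_
    rw [hone]
    simp only [Pi.mul_apply]
    generalize Real.log (2 * s₀) = L at hlog
    field_simp
    ring
  have ht := (hasDerivAt_iff_tendsto_slope.mp hd).mono_left
    (nhdsWithin_mono s₀ (fun x (hx : x ∈ Set.Ioi s₀) => ne_of_gt hx))
  obtain ⟨s, hsl, hss⟩ := ((ht.eventually (lt_mem_nhds hpos)).and self_mem_nhdsWithin).exists
  have hss' : s₀ < s := hss
  refine ⟨s, hss', ?_⟩
  rw [slope_def_field, div_pos_iff_of_pos_right (sub_pos.mpr hss')] at hsl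
  exact sub_pos.mp hsl
end
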